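/- arXiv:2305.06256 — 7 statements merged into one kernel-verified Lean document; each statement's English description precedes it below -/
import Mathlib

section
/- Let u : ℝ_{≥0}^K → ℝ be continuous and strictly increasing, with indirect utility v(p,m) = max{u(x) : x ∈ ℝ_{≥0}^K, ⟨p,x⟩ ≤ m} for strictly positive p and m ≥ 0. Then v is continuous on {p ∈ ℝ^K : p strictly positive} × ℝ_{≥0}, and v is quasiconvex in (p,m): for all strictly positive p, p', all m, m' ≥ 0 and all t ∈ [0,1], v(tp + (1−t)p', tm + (1−t)m') ≤ max(v(p,m), v(p',m')). -/
/-- Euclidean inner product on `ℝ^K`. -/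
noncomputable def dot {K : ℕ} (p x : Fin K → ℝ) : ℝ := ∑ k, p k * x k

/-- Membership in the nonnegative orthant `ℝ_{≥0}^K`. -/
def nonneg {K : ℕ} (x : Fin K → ℝ) : Prop := ∀ k, 0 ≤ x k

/-- Strictly positive price vector. -/
def posVec {K : ℕ} (p : Fin K → ℝ) : Prop := ∀ k, 0 < p k

/-- `v` is the indirect utility of `u`: for every strictly positive price `p` and income
`m ≥ 0`, `v p m` is the maximum of `u` over the budget set
`{x ∈ ℝ_{≥0}^K : ⟨p,x⟩ ≤ m}`. -/
def IsIndirectUtility {K : ℕ} (u : (Fin K → ℝ) → ℝ) (v : (Fin K → ℝ) → ℝ → ℝ) : Prop :=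
  ∀ p m, posVec p → 0 ≤ m →
    IsGreatest {t | ∃ x, nonneg x ∧ dot p x ≤ m ∧ u x = t} (v p m)

open Filter Topology

lemma continuous_dot {K : ℕ} (x : Fin K → ℝ) : Continuous fun p : Fin K → ℝ => dot p x := by
  unfold dot; fun_prop

lemma continuous_dot_right {K : ℕ} (p : Fin K → ℝ) : Continuous fun x : Fin K → ℝ => dot p x := by
  unfold dot; fun_prop

lemma dot_smul_right {K : ℕ} (p x : Fin K → ℝ) (s : ℝ) : dot p (s • x) = s * dot p x := by
  simp only [dot, Finset.mul_sum, Pi.smul_apply, smul_eq_mul]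
  exact Finset.sum_congr rfl fun k _ => by ring

lemma dot_combo_left {K : ℕ} (p p' x : Fin K → ℝ) (s t : ℝ) :
    dot (s • p + t • p') x = s * dot p x + t * dot p' x := by
  simp only [dot, Finset.mul_sum, ← Finset.sum_add_distrib, Pi.add_apply, Pi.smul_apply,
    smul_eq_mul]
  exact Finset.sum_congr rfl fun k _ => by ring

lemma mul_le_dot {K : ℕ} {p x : Fin K → ℝ} (hp : posVec p) (hx : nonneg x) (k : Fin K) :
    p k * x k ≤ dot p x :=
  Finset.single_le_sum (f := fun k => p k * x k)
    (fun j _ => mul_nonneg (hp j).le (hx j)) (Finset.mem_univ k)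

lemma isClosed_setOf_nonneg {K : ℕ} : IsClosed {x : Fin K → ℝ | nonneg x} := by
  simp only [nonneg, Set.ofPred_forall]
  exact isClosed_iInter fun k => isClosed_le continuous_const (continuous_apply k)

lemma isCompact_budget {K : ℕ} {p : Fin K → ℝ} (hp : posVec p) (m : ℝ) :
    IsCompact {x : Fin K → ℝ | nonneg x ∧ dot p x ≤ m} := by
  refine (isCompact_Icc (a := (0 : Fin K → ℝ)) (b := fun k => m / p k)).of_isClosed_subset
    (isClosed_setOf_nonneg.inter (isClosed_le (continuous_dot_right p) continuous_const)) ?_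
  rintro x ⟨hx, hxm⟩
  refine ⟨hx, fun k => ?_⟩
  rw [le_div_iff₀ (hp k), mul_comm]
  exact (mul_le_dot hp hx k).trans hxm

/-- If every bundle affordable at `(p, m)` has utility below `c`, the same holds at `(p, M)` for
some income `M > m`. -/
lemma exists_income_gt_forall_lt {K : ℕ} {u : (Fin K → ℝ) → ℝ}
    (hu : ContinuousOn u {x | nonneg x}) {p : Fin K → ℝ} (hp : posVec p) {m c : ℝ}
    (h : ∀ x, nonneg x → dot p x ≤ m → u x < c) :
    ∃ M > m, ∀ x, nonneg x → dot p x < M → u x < c := by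
  set C : Set (Fin K → ℝ) := {x | nonneg x ∧ dot p x ≤ m + 1} ∩ u ⁻¹' Set.Ici c with hC
  have hcomp : IsCompact C := by
    have hb := isCompact_budget hp (m + 1)
    exact hb.of_isClosed_subset
      ((hu.mono fun x hx => hx.1).preimage_isClosed_of_isClosed hb.isClosed isClosed_Ici)
      Set.inter_subset_left
  rcases C.eq_empty_or_nonempty with he | hne
  · refine ⟨m + 1, by linarith, fun x hx hxm => ?_⟩
    by_contra! hc
    have : x ∈ C := ⟨⟨hx, hxm.le⟩, hc⟩
    simp [he] at this
  · obtain ⟨z, hz, hmin⟩ := hcomp.exists_isMinOn hne (continuous_dot_right p).continuousOn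
    refine ⟨min (m + 1) (dot p z), lt_min (by linarith) ?_, fun x hx hxm => ?_⟩
    · by_contra! hzm
      exact (h z hz.1.1 hzm).not_ge hz.2
    · by_contra! hc
      obtain ⟨h1, h2⟩ := lt_min_iff.1 hxm
      exact h2.not_ge (hmin (show x ∈ C from ⟨⟨hx, h1.le⟩, hc⟩))

/-- Near `(p₀, m₀)`, every affordable bundle costs less than `M` at prices `p₀`, for any
`M > m₀`. -/
lemma eventually_budget_dot_lt {K : ℕ} {p₀ : Fin K → ℝ} (hp₀ : posVec p₀) {m₀ M : ℝ}
    (hM : m₀ < M) :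
    ∀ᶠ q : (Fin K → ℝ) × ℝ in 𝓝 (p₀, m₀), ∀ x, nonneg x → dot q.1 x ≤ q.2 → dot p₀ x < M := by
  obtain ⟨r, hrM, hr⟩ : ∃ r : ℝ, r * m₀ < M ∧ 1 < r := by
    have h : ∀ᶠ r : ℝ in 𝓝[>] 1, r * m₀ < M :=
      (((continuous_mul_const m₀).tendsto 1).mono_left nhdsWithin_le_nhds).eventually_lt_const
        (by simpa using hM)
    exact (h.and self_mem_nhdsWithin).exists
  have h1 : ∀ᶠ q : (Fin K → ℝ) × ℝ in 𝓝 (p₀, m₀), r * q.2 < M :=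
    ContinuousAt.eventually_lt (by fun_prop) continuousAt_const hrM
  have h2 : ∀ᶠ q : (Fin K → ℝ) × ℝ in 𝓝 (p₀, m₀), ∀ k, p₀ k < r * q.1 k :=
    eventually_all.2 fun k => ContinuousAt.eventually_lt continuousAt_const
      (by fun_prop) (lt_mul_of_one_lt_left (hp₀ k) hr)
  filter_upwards [h1, h2] with q hq1 hq2 x hx hxq
  calc dot p₀ x ≤ r * dot q.1 x := by
        simp only [dot, Finset.mul_sum, ← mul_assoc]
        exact Finset.sum_le_sum fun k _ => mul_le_mul_of_nonneg_right (hq2 k).le (hx k)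
    _ ≤ r * q.2 := mul_le_mul_of_nonneg_left hxq (by linarith)
    _ < M := hq1

/-- A bundle affordable at `(p₀, m₀)` with utility above `c` can be perturbed to one affordable at
any nearby price and income, still with utility above `c`. -/
lemma eventually_exists_budget_lt {K : ℕ} {u : (Fin K → ℝ) → ℝ}
    (hu : ContinuousOn u {x | nonneg x}) {p₀ x₀ : Fin K → ℝ} {m₀ c : ℝ} (hp₀ : posVec p₀)
    (hm₀ : 0 ≤ m₀) (hx₀ : nonneg x₀) (hxm : dot p₀ x₀ ≤ m₀) (hc : c < u x₀) :
    ∀ᶠ q : (Fin K → ℝ) × ℝ in 𝓝[{q | posVec q.1 ∧ 0 ≤ q.2}] (p₀, m₀),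
      ∃ x, nonneg x ∧ dot q.1 x ≤ q.2 ∧ c < u x := by
  rcases hm₀.eq_or_lt with rfl | hm
  · have hx0 : x₀ = 0 := by
      ext k
      have h := (mul_le_dot hp₀ hx₀ k).trans hxm
      exact le_antisymm (nonpos_of_mul_nonpos_right h (hp₀ k)) (hx₀ k)
    filter_upwards [self_mem_nhdsWithin] with q hq
    exact ⟨x₀, hx₀, by simpa [hx0, dot] using hq.2, hc⟩
  · set s : (Fin K → ℝ) × ℝ → ℝ := fun q => q.2 / max q.2 (dot q.1 x₀) with hs
    have hs₀ : s (p₀, m₀) = 1 := by simp [hs, max_eq_left hxm, hm.ne']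
    have hs_cont : ContinuousAt s (p₀, m₀) := by
      refine continuousAt_snd.div (Continuous.continuousAt ?_) (lt_max_of_lt_left hm).ne'
      exact continuous_snd.max ((continuous_dot x₀).comp continuous_fst)
    have hs_nonneg : ∀ q : (Fin K → ℝ) × ℝ, 0 ≤ q.2 → 0 ≤ s q := fun q hq =>
      div_nonneg hq (le_max_of_le_left hq)
    have hmem : ∀ q : (Fin K → ℝ) × ℝ, 0 ≤ q.2 → nonneg (s q • x₀) := fun q hq k =>
      mul_nonneg (hs_nonneg q hq) (hx₀ k)
    have hlim : Tendsto (fun q => s q • x₀) (𝓝[{q | posVec q.1 ∧ 0 ≤ q.2}] (p₀, m₀))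
        (𝓝[{x | nonneg x}] x₀) := by
      refine tendsto_nhdsWithin_iff.2 ⟨?_, ?_⟩
      · have h : Tendsto (fun q => s q • x₀) (𝓝 (p₀, m₀)) (𝓝 (s (p₀, m₀) • x₀)) :=
          hs_cont.smul continuousAt_const
        rw [hs₀, one_smul] at h
        exact h.mono_left nhdsWithin_le_nhds
      · filter_upwards [self_mem_nhdsWithin] with q hq using hmem q hq.2
    filter_upwards [self_mem_nhdsWithin, ((hu x₀ hx₀).tendsto.comp hlim).eventually_const_lt hc]
      with q hq hcq
    refine ⟨s q • x₀, hmem q hq.2, ?_, hcq⟩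
    rw [dot_smul_right]
    calc s q * dot q.1 x₀ ≤ s q * max q.2 (dot q.1 x₀) :=
          mul_le_mul_of_nonneg_left (le_max_right _ _) (hs_nonneg q hq.2)
      _ = q.2 := div_mul_cancel_of_imp fun h => le_antisymm ((le_max_left _ _).trans_eq h) hq.2

/-- the indirect utility is continuous on the set of strictly positive prices
and nonnegative incomes, and is quasiconvex in `(p,m)`. -/
theorem indirect_utility_continuous_quasiconvex {K : ℕ} (hK : 1 ≤ K)
    (u : (Fin K → ℝ) → ℝ)
    (hu_cont : ContinuousOn u {x | nonneg x})
    (hu_mono : ∀ x y, nonneg x → nonneg y → (∀ k, x k ≤ y k) → x ≠ y → u x < u y)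
    (v : (Fin K → ℝ) → ℝ → ℝ)
    (hv : IsIndirectUtility u v) :
    ContinuousOn (fun q : (Fin K → ℝ) × ℝ => v q.1 q.2) {q | posVec q.1 ∧ 0 ≤ q.2} ∧
    (∀ p p' m m' t, posVec p → posVec p' → 0 ≤ m → 0 ≤ m' → 0 ≤ t → t ≤ 1 →
      v (t • p + (1 - t) • p') (t * m + (1 - t) * m') ≤ max (v p m) (v p' m')) := by
  refine ⟨?_, ?_⟩
  · rintro ⟨p₀, m₀⟩ ⟨hp₀, hm₀⟩
    obtain ⟨⟨x₀, hx₀, hxm, hux⟩, hub⟩ := hv p₀ m₀ hp₀ hm₀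
    refine tendsto_order.2 ⟨fun c hc => ?_, fun c hc => ?_⟩
    · filter_upwards [self_mem_nhdsWithin, eventually_exists_budget_lt hu_cont hp₀ hm₀ hx₀ hxm
        (hc.trans_eq hux.symm)] with q hq hex
      obtain ⟨x, hx, hxq, hcx⟩ := hex
      exact hcx.trans_le ((hv q.1 q.2 hq.1 hq.2).2 ⟨x, hx, hxq, rfl⟩)
    · obtain ⟨M, hM, hlt⟩ := exists_income_gt_forall_lt hu_cont hp₀
        fun x hx hxm => (hub ⟨x, hx, hxm, rfl⟩).trans_lt hc
      filter_upwards [self_mem_nhdsWithin,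
        nhdsWithin_le_nhds (eventually_budget_dot_lt hp₀ hM)] with q hq hqM
      obtain ⟨x, hx, hxq, hxv⟩ := (hv q.1 q.2 hq.1 hq.2).1
      exact hxv ▸ hlt x hx (hqM x hx hxq)
  · intro p p' m m' t hp hp' hm hm' ht ht1
    have ht' : 0 ≤ 1 - t := sub_nonneg.2 ht1
    have hpos : posVec (t • p + (1 - t) • p') := fun k =>
      convex_Ioi (0 : ℝ) (hp k) (hp' k) ht ht' (by ring)
    obtain ⟨x, hx, hxm, hxv⟩ := (hv _ _ hpos
      (add_nonneg (mul_nonneg ht hm) (mul_nonneg ht' hm'))).1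
    rw [dot_combo_left] at hxm
    rw [← hxv]
    by_cases h : dot p x ≤ m
    · exact le_max_of_le_left ((hv p m hp hm).2 ⟨x, hx, h, rfl⟩)
    · by_cases h' : dot p' x ≤ m'
      · exact le_max_of_le_right ((hv p' m' hp' hm').2 ⟨x, hx, h', rfl⟩)
      · have hgt : 0 < t * (dot p x - m) + (1 - t) * (dot p' x - m') :=
          convex_Ioi (0 : ℝ) (sub_pos.2 (not_le.1 h)) (sub_pos.2 (not_le.1 h')) ht ht' (by ring)
        linarith
end

section
/- Let u : ℝ_{≥0}^K → ℝ be continuous, strictly increasing, and quasiconcave, with indirect utility v(p,m) = max{u(x) : x ∈ ℝ_{≥0}^K, ⟨p,x⟩ ≤ m} for strictly positive p and m ≥ 0. Then the utility function is recovered as the dual of the indirect utility: for every x ∈ ℝ_{≥0}^K with x ≠ 0 and every m > 0, u(x) = inf{v(p,m) : p ∈ ℝ^K strictly positive, ⟨p,x⟩ = m}. -/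
theorem dot_smul_left {K : ℕ} (c : ℝ) (p x : Fin K → ℝ) : dot (c • p) x = c * dot p x := by
  simp [dot, Finset.mul_sum, mul_assoc]

theorem posVec.dot_pos {K : ℕ} {p x : Fin K → ℝ} (hp : posVec p) (hx : nonneg x) (hx0 : x ≠ 0) :
    0 < dot p x := by
  obtain ⟨k, hk⟩ := Function.ne_iff.mp hx0
  exact Finset.sum_pos' (fun i _ => mul_nonneg (hp i).le (hx i))
    ⟨k, Finset.mem_univ k, mul_pos (hp k) ((hx k).lt_of_ne' hk)⟩

/-- A continuous linear functional bounded below on a nonempty upward closed set is nonnegative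
on the standard basis. -/
theorem nonneg_single_of_lt_of_isUpperSet {K : ℕ} {S : Set (Fin K → ℝ)} (hS : IsUpperSet S)
    (hne : S.Nonempty) (f : (Fin K → ℝ) →L[ℝ] ℝ) {b : ℝ} (hf : ∀ y ∈ S, b < f y) (k : Fin K) :
    0 ≤ f (Pi.single k 1) := by
  by_contra! hk
  obtain ⟨y, hy⟩ := hne
  set e : Fin K → ℝ := Pi.single k 1
  have ht : 0 ≤ (b - f y) / f e := div_nonneg_of_nonpos (by linarith [hf y hy]) hk.le
  have he : (0 : Fin K → ℝ) ≤ e := Pi.single_nonneg.mpr zero_le_one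
  have h := hf _ (hS (le_add_of_nonneg_right (smul_nonneg ht he)) hy)
  rw [map_add, map_smul, smul_eq_mul, div_mul_cancel₀ _ hk.ne] at h
  linarith

/-- A point outside a closed convex upward closed subset of the nonnegative orthant is separated
from it by a strictly positive price vector. -/
theorem exists_posVec_forall_dot_lt {K : ℕ} {S : Set (Fin K → ℝ)} (hconv : Convex ℝ S)
    (hclosed : IsClosed S) (hupper : IsUpperSet S) (hnonneg : ∀ y ∈ S, nonneg y)
    {x : Fin K → ℝ} (hx : nonneg x) (hxS : x ∉ S) :
    ∃ p, posVec p ∧ ∀ y ∈ S, dot p x < dot p y := by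
  rcases S.eq_empty_or_nonempty with rfl | hne
  · exact ⟨1, fun _ => one_pos, by simp⟩
  obtain ⟨f, b, hfx, hfS⟩ := geometric_hahn_banach_point_closed hconv hclosed hxS
  have hsum : 0 ≤ ∑ k, x k := Finset.sum_nonneg fun k _ => hx k
  set δ : ℝ := (b - f x) / (1 + ∑ k, x k)
  have hδ : 0 < δ := div_pos (by linarith) (by linarith)
  have hδx : δ * (1 + ∑ k, x k) = b - f x := div_mul_cancel₀ _ (by linarith)
  have hdot (y : Fin K → ℝ) :
      dot (fun k => f (Pi.single k 1) + δ) y = f y + δ * ∑ k, y k := by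
    have hy := LinearMap.pi_apply_eq_sum_univ f.toLinearMap y
    simp only [ContinuousLinearMap.coe_coe, smul_eq_mul] at hy
    rw [hy, dot, Finset.mul_sum, ← Finset.sum_add_distrib]
    refine Finset.sum_congr rfl fun k _ => ?_
    have : (fun j => if k = j then (1 : ℝ) else 0) = Pi.single k 1 := by
      ext j; simp [Pi.single_apply, eq_comm]
    rw [this]
    ring
  refine ⟨fun k => f (Pi.single k 1) + δ, fun k => ?_, fun y hy => ?_⟩
  · linarith [nonneg_single_of_lt_of_isUpperSet hupper hne f hfS k]
  · rw [hdot, hdot]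
    have hy' : 0 ≤ δ * ∑ k, y k :=
      mul_nonneg hδ.le (Finset.sum_nonneg fun k _ => hnonneg y hy k)
    linarith [hfS y hy]

/-- for a continuous, strictly increasing, quasiconcave utility, the utility
is recovered as the dual of the indirect utility:
`u(x) = inf {v(p,m) : p strictly positive, ⟨p,x⟩ = m}` for `x ≠ 0` and `m > 0`. -/
theorem utility_is_dual_of_indirect_utility {K : ℕ} (hK : 1 ≤ K)
    (u : (Fin K → ℝ) → ℝ)
    (hu_cont : ContinuousOn u {x | nonneg x})
    (hu_mono : ∀ x y, nonneg x → nonneg y → (∀ k, x k ≤ y k) → x ≠ y → u x < u y)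
    (hu_qc : ∀ c : ℝ, Convex ℝ {x | nonneg x ∧ c ≤ u x})
    (v : (Fin K → ℝ) → ℝ → ℝ)
    (hv : IsIndirectUtility u v) :
    ∀ x, nonneg x → x ≠ 0 → ∀ m : ℝ, 0 < m →
      u x = sInf {t | ∃ p, posVec p ∧ dot p x = m ∧ v p m = t} := by
  intro x hx hx0 m hm
  have key (c : ℝ) (hc : u x < c) : ∃ p, posVec p ∧ dot p x = m ∧ v p m < c := by
    obtain ⟨p, hp, hpS⟩ := exists_posVec_forall_dot_lt (hu_qc c)
      (hu_cont.preimage_isClosed_of_isClosed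
        (isClosed_Ici : IsClosed (Set.Ici (0 : Fin K → ℝ))) isClosed_Ici)
      (fun y z hyz hy => by
        have hz : nonneg z := fun k => (hy.1 k).trans (hyz k)
        rcases eq_or_ne y z with rfl | hne
        · exact hy
        · exact ⟨hz, hy.2.trans (hu_mono y z hy.1 hz hyz hne).le⟩)
      (fun y hy => hy.1) hx (fun h => hc.not_ge h.2)
    have hpx := hp.dot_pos hx hx0
    have hs : 0 < m / dot p x := div_pos hm hpx
    have hq : posVec ((m / dot p x) • p) := fun k => mul_pos hs (hp k)
    refine ⟨(m / dot p x) • p, hq, ?_, ?_⟩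
    · rw [dot_smul_left, div_mul_cancel₀ _ hpx.ne']
    · obtain ⟨z, hz, hzm, hzv⟩ := (hv _ m hq hm.le).1
      rw [← hzv]
      by_contra! hcz
      rw [dot_smul_left] at hzm
      have := mul_lt_mul_of_pos_left (hpS z ⟨hz, hcz⟩) hs
      rw [div_mul_cancel₀ _ hpx.ne'] at this
      linarith
  symm
  apply csInf_eq_of_forall_ge_of_forall_gt_exists_lt
  · obtain ⟨p, hp, hpx, -⟩ := key (u x + 1) (by linarith)
    exact ⟨v p m, p, hp, hpx, rfl⟩
  · rintro _ ⟨p, hp, hpx, rfl⟩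
    exact (hv p m hp hm.le).2 ⟨x, hx, hpx.le, rfl⟩
  · intro c hc
    obtain ⟨p, hp, hpx, hlt⟩ := key c hc
    exact ⟨v p m, ⟨p, hp, hpx, rfl⟩, hlt⟩
end

section
/- Assume each utility u_i is continuous and strictly increasing. If a vector u ∈ ℝ^N belongs to the intersection UPS ∩ VPS, then u is a maximal element of the UPS and a minimal element of the VPS. -/
/-- The set of feasible allocations `F(w)`. -/
def Feasible {K N : ℕ} (w : Fin K → ℝ) (x : Fin N → Fin K → ℝ) : Prop :=
  (∀ i, nonneg (x i)) ∧ ∀ k, (∑ i, x i k) ≤ w k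

/-- Normalized strictly positive prices `Σ_K^+(w)`. -/
def PriceSimplex {K : ℕ} (w p : Fin K → ℝ) : Prop := posVec p ∧ dot p w = 1

/-- Income distributions `Σ_N`. -/
def IncomeSimplex {N : ℕ} (m : Fin N → ℝ) : Prop := (∀ i, 0 ≤ m i) ∧ (∑ i, m i) = 1

/-- The utility possibility set. -/
def UPS {K N : ℕ} (w : Fin K → ℝ) (u : Fin N → (Fin K → ℝ) → ℝ) : Set (Fin N → ℝ) :=
  {e | ∃ x, Feasible w x ∧ ∀ i, e i = u i (x i)}

/-- The indirect utility possibility set. -/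
def VPS {K N : ℕ} (w : Fin K → ℝ) (v : Fin N → (Fin K → ℝ) → ℝ → ℝ) : Set (Fin N → ℝ) :=
  {e | ∃ p m, PriceSimplex w p ∧ IncomeSimplex m ∧ ∀ i, e i = v i p (m i)}

/-- A Walrasian equilibrium with income distribution `m`. -/
def WalrasEq {K N : ℕ} (w : Fin K → ℝ) (u : Fin N → (Fin K → ℝ) → ℝ)
    (v : Fin N → (Fin K → ℝ) → ℝ → ℝ)
    (x : Fin N → Fin K → ℝ) (p : Fin K → ℝ) (m : Fin N → ℝ) : Prop :=
  Feasible w x ∧ PriceSimplex w p ∧ ∀ i, dot p (x i) = m i ∧ u i (x i) = v i p (m i)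

/-- Pareto optimality of an allocation `x ∈ F(w)`. -/
def ParetoOptimal {K N : ℕ} (w : Fin K → ℝ) (u : Fin N → (Fin K → ℝ) → ℝ)
    (x : Fin N → Fin K → ℝ) : Prop :=
  Feasible w x ∧
    ¬ ∃ x', Feasible w x' ∧ (∀ i, u i (x i) ≤ u i (x' i)) ∧ ∃ j, u j (x j) < u j (x' j)

/-- A bundle that is at least as good as the best affordable one exhausts the income, by strict
monotonicity of the utility. -/
theorem IsIndirectUtility.le_dot_of_le {K : ℕ} (hK : 1 ≤ K) {u : (Fin K → ℝ) → ℝ}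
    {v : (Fin K → ℝ) → ℝ → ℝ} (hv : IsIndirectUtility u v)
    (hu : ∀ x y, nonneg x → nonneg y → (∀ k, x k ≤ y k) → x ≠ y → u x < u y)
    {p x : Fin K → ℝ} {m : ℝ} (hp : posVec p) (hm : 0 ≤ m) (hx : nonneg x)
    (h : v p m ≤ u x) : m ≤ dot p x := by
  by_contra! hlt
  let k₀ : Fin K := ⟨0, hK⟩
  let y : Fin K → ℝ := x + Pi.single k₀ ((m - dot p x) / p k₀)
  have hδ : 0 < (m - dot p x) / p k₀ := div_pos (sub_pos.2 hlt) (hp k₀)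
  have hle : ∀ k, x k ≤ y k :=
    le_add_of_nonneg_right (a := x) (Pi.single_nonneg.2 hδ.le)
  have hy : nonneg y := fun k => (hx k).trans (hle k)
  have hne : x ≠ y := fun heq => by
    have := congrFun heq k₀
    simp only [y, Pi.add_apply, Pi.single_eq_same] at this
    linarith
  have hdot : dot p y = m := by
    have : dot p y = dot p x + p k₀ * ((m - dot p x) / p k₀) := by
      simp [y, dot, mul_add, Finset.sum_add_distrib, Pi.single_apply]
    rw [this, mul_div_cancel₀ _ (hp k₀).ne']
    ring
  have hbest := (hv p m hp hm).2 ⟨_, hy, hdot.le, rfl⟩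
  linarith [hu x _ hx hy hle hne]

/-- The value of a feasible allocation is at most the value of the total endowment. -/
theorem Feasible.sum_dot_le {K N : ℕ} {w p : Fin K → ℝ} {x : Fin N → Fin K → ℝ}
    (hx : Feasible w x) (hp : posVec p) : ∑ i, dot p (x i) ≤ dot p w := by
  simp only [dot]
  rw [Finset.sum_comm]
  refine Finset.sum_le_sum fun k _ => ?_
  rw [← Finset.mul_sum]
  exact mul_le_mul_of_nonneg_left (hx.2 k) (hp k).le

/-- An element of the UPS that dominates an element of the VPS is equal to it. -/
theorem eq_of_mem_VPS_of_mem_UPS_of_le {K N : ℕ} (hK : 1 ≤ K) {w : Fin K → ℝ}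
    {u : Fin N → (Fin K → ℝ) → ℝ}
    (hu : ∀ i x y, nonneg x → nonneg y → (∀ k, x k ≤ y k) → x ≠ y → u i x < u i y)
    {v : Fin N → (Fin K → ℝ) → ℝ → ℝ} (hv : ∀ i, IsIndirectUtility (u i) (v i))
    {a b : Fin N → ℝ} (ha : a ∈ VPS w v) (hb : b ∈ UPS w u) (hab : ∀ i, a i ≤ b i) :
    a = b := by
  obtain ⟨p, m, ⟨hp, hpw⟩, ⟨hm, hm_sum⟩, ha⟩ := ha
  obtain ⟨x, hx, hb⟩ := hb
  have hle : ∀ i ∈ Finset.univ, m i ≤ dot p (x i) := fun i _ =>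
    (hv i).le_dot_of_le hK (hu i) hp (hm i) (hx.1 i) (by rw [← ha, ← hb]; exact hab i)
  have hsum : ∑ i, m i = ∑ i, dot p (x i) :=
    (Finset.sum_le_sum hle).antisymm ((hx.sum_dot_le hp).trans_eq (hpw.trans hm_sum.symm))
  have heq := (Finset.sum_eq_sum_iff_of_le hle).1 hsum
  funext i
  refine (hab i).antisymm ?_
  rw [ha, hb]
  exact (hv i p (m i) hp (hm i)).2 ⟨x i, hx.1 i, (heq i (Finset.mem_univ i)).ge, rfl⟩

/-- Lemma A1: any element of `UPS ∩ VPS` is a maximal element of the UPS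
and a minimal element of the VPS. -/
theorem inter_UPS_VPS_maximal_minimal {K N : ℕ} (hK : 1 ≤ K) (hN : 1 ≤ N)
    (w : Fin K → ℝ) (hw : posVec w)
    (u : Fin N → (Fin K → ℝ) → ℝ)
    (hu_cont : ∀ i, ContinuousOn (u i) {x | nonneg x})
    (hu_mono : ∀ i x y, nonneg x → nonneg y → (∀ k, x k ≤ y k) → x ≠ y → u i x < u i y)
    (v : Fin N → (Fin K → ℝ) → ℝ → ℝ)
    (hv : ∀ i, IsIndirectUtility (u i) (v i)) :
    ∀ e : Fin N → ℝ, e ∈ UPS w u ∩ VPS w v →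
      (∀ e' ∈ UPS w u, (∀ i, e i ≤ e' i) → e' = e) ∧
      (∀ e' ∈ VPS w v, (∀ i, e' i ≤ e i) → e' = e) := by
  rintro e ⟨heU, heV⟩
  exact ⟨fun e' he' h => (eq_of_mem_VPS_of_mem_UPS_of_le hK hu_mono hv heV he' h).symm,
    fun e' he' h => eq_of_mem_VPS_of_mem_UPS_of_le hK hu_mono hv he' heU h⟩
end

section
/- Assume each utility u_i is continuous, strictly increasing, quasiconcave, and differentiable on the interior of ℝ_{≥0}^K. Then every maximal element of the UPS belongs to the VPS: if x ∈ F(w) is such that (u_1(x_1),…,u_N(x_N)) is a maximal element of the UPS, then Σ_i x_i = w and there exists a single price vector p ∈ Σ_K^+(w) such that u_i(x_i) = v_i(p, ⟨p,x_i⟩) for every i; the incomes m_i = ⟨p,x_i⟩ form an income distribution in Σ_N. -/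
theorem dot_add {K : ℕ} (p x y : Fin K → ℝ) : dot p (x + y) = dot p x + dot p y := by
  simp [dot, mul_add, Finset.sum_add_distrib]

theorem dot_sub {K : ℕ} (p x y : Fin K → ℝ) : dot p (x - y) = dot p x - dot p y := by
  simp [dot, mul_sub, Finset.sum_sub_distrib]

theorem dot_smul {K : ℕ} (p x : Fin K → ℝ) (t : ℝ) : dot p (t • x) = t * dot p x := by
  simp only [dot, Pi.smul_apply, smul_eq_mul, Finset.mul_sum]
  exact Finset.sum_congr rfl fun k _ => by ring

theorem smul_dot {K : ℕ} (p x : Fin K → ℝ) (t : ℝ) : dot (t • p) x = t * dot p x := by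
  simp [dot, Finset.mul_sum, mul_assoc]

theorem dot_sum {K N : ℕ} (p : Fin K → ℝ) (x : Fin N → Fin K → ℝ) :
    dot p (∑ i, x i) = ∑ i, dot p (x i) := by
  simp only [dot, Finset.sum_apply, Finset.mul_sum]
  exact Finset.sum_comm

theorem dot_single {K : ℕ} (p : Fin K → ℝ) (k : Fin K) : dot p (Pi.single k 1) = p k := by
  simp [dot, Pi.single_apply]

theorem dot_nonneg {K : ℕ} {p x : Fin K → ℝ} (hp : nonneg p) (hx : nonneg x) : 0 ≤ dot p x :=
  Finset.sum_nonneg fun k _ => mul_nonneg (hp k) (hx k)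

theorem eq_zero_of_dot_nonpos {K : ℕ} {p x : Fin K → ℝ} (hp : posVec p) (hx : nonneg x)
    (h : dot p x ≤ 0) : x = 0 := by
  have h0 : dot p x = 0 := le_antisymm h (dot_nonneg (fun k => (hp k).le) hx)
  have hz := (Finset.sum_eq_zero_iff_of_nonneg
    fun k _ => mul_nonneg (hp k).le (hx k)).1 h0
  funext k
  exact (mul_eq_zero.1 (hz k (Finset.mem_univ k))).resolve_left (hp k).ne'

/-- A convex set disjoint from the open lower orthant below one of its points `w` is supported
at `w` by a linear functional with positive coordinate sum. -/
theorem exists_supporting_price {K : ℕ} {w : Fin K → ℝ} {A : Set (Fin K → ℝ)}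
    (hA : Convex ℝ A) (hwA : w ∈ A) (hdisj : ∀ z ∈ A, ¬ ∀ k, z k < w k) :
    ∃ p : Fin K → ℝ, 0 < dot p 1 ∧ ∀ z ∈ A, dot p w ≤ dot p z := by
  have hBset : {z : Fin K → ℝ | ∀ k, z k < w k} = Set.univ.pi fun k => Set.Iio (w k) := by
    ext z; simp
  have hBo : IsOpen {z : Fin K → ℝ | ∀ k, z k < w k} := by
    rw [hBset]; exact isOpen_set_pi Set.finite_univ fun k _ => isOpen_Iio
  have hBc : Convex ℝ {z : Fin K → ℝ | ∀ k, z k < w k} := by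
    rw [hBset]; exact convex_pi fun k _ => convex_Iio (w k)
  obtain ⟨f, s, hB, hs⟩ := geometric_hahn_banach_open hBc hBo hA
    (Set.disjoint_left.2 fun z hz hzA => hdisj z hzA hz)
  have hf : ∀ z, f z = dot (fun k => f (Pi.single k 1)) z := fun z => by
    have h := LinearMap.pi_apply_eq_sum_univ (f : (Fin K → ℝ) →ₗ[ℝ] ℝ) z
    simp only [ContinuousLinearMap.coe_coe, smul_eq_mul] at h
    rw [h, dot]
    refine Finset.sum_congr rfl fun k _ => ?_
    rw [mul_comm]
    congr 2
    funext j
    simp [Pi.single_apply, eq_comm]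
  have hlow : ∀ t : ℝ, 0 < t → f w - t * f 1 < s := fun t ht => by
    have h := hB (w - t • 1) fun k => by simpa using ht
    simpa using h
  have hws : s ≤ f w := hs w hwA
  have h1 : 0 < f 1 := by linarith [hlow 1 one_pos]
  have hsw : f w ≤ s := by
    by_contra! hlt
    have h := hlow ((f w - s) / f 1) (div_pos (by linarith) h1)
    rw [div_mul_cancel₀ _ h1.ne'] at h
    linarith
  refine ⟨fun k => f (Pi.single k 1), by rwa [← hf], fun z hz => ?_⟩
  rw [← hf, ← hf]
  exact hsw.trans (hs z hz)

/-- An allocation that weakly improves on one with maximal utilities exhausts the resources. -/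
theorem sum_eq_of_maximal {K N : ℕ} (hN : 1 ≤ N) {w : Fin K → ℝ}
    {u : Fin N → (Fin K → ℝ) → ℝ}
    (hu_mono : ∀ i x y, nonneg x → nonneg y → (∀ k, x k ≤ y k) → x ≠ y → u i x < u i y)
    {x : Fin N → Fin K → ℝ}
    (hmax : ∀ e' ∈ UPS w u, (∀ i, u i (x i) ≤ e' i) → e' = fun i => u i (x i))
    {y : Fin N → Fin K → ℝ} (hy : Feasible w y) (hxy : ∀ i, u i (x i) ≤ u i (y i)) :
    ∑ i, y i = w := by
  by_contra hne
  let i₀ : Fin N := ⟨0, hN⟩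
  let r : Fin K → ℝ := w - ∑ i, y i
  have hr : nonneg r := fun k => by
    have := hy.2 k
    simpa [r] using this
  have hr0 : r ≠ 0 := fun h => hne (sub_eq_zero.1 h).symm
  have hlt : u i₀ (y i₀) < u i₀ (y i₀ + r) :=
    hu_mono i₀ _ _ (hy.1 i₀) (fun k => add_nonneg (hy.1 i₀ k) (hr k))
      (fun k => le_add_of_nonneg_right (hr k)) (by simpa using hr0)
  let y' : Fin N → Fin K → ℝ := y + Pi.single i₀ r
  have hy'0 : y' i₀ = y i₀ + r := by simp [y']
  have hy'ne : ∀ i, i ≠ i₀ → y' i = y i := fun i hi => by simp [y', hi]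
  have hsum : ∑ i, y' i = w := by
    simp [y', Finset.sum_add_distrib, r]
  have hfeas : Feasible w y' := by
    refine ⟨fun i => ?_, fun k => ?_⟩
    · by_cases hi : i = i₀
      · rw [hi, hy'0]; exact fun k => add_nonneg (hy.1 i₀ k) (hr k)
      · rw [hy'ne i hi]; exact hy.1 i
    · rw [← Finset.sum_apply, hsum]
  have heq := hmax (fun i => u i (y' i)) ⟨y', hfeas, fun _ => rfl⟩ fun i => by
    by_cases hi : i = i₀
    · simp only [hi, hy'0]; exact (hxy i₀).trans hlt.le
    · simp only [hy'ne i hi]; exact hxy i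
  have h0 := congrFun heq i₀
  simp only [hy'0] at h0
  linarith [hxy i₀]

/-- If every weakly preferred bundle costs at least as much as `x`, and `x` has positive cost,
then every affordable bundle is weakly worse than `x`. -/
theorem le_of_dot_le_of_dot_pos {K : ℕ} {u : (Fin K → ℝ) → ℝ}
    (hu : ContinuousOn u {x | nonneg x}) {p x y : Fin K → ℝ}
    (hx : ∀ z, nonneg z → u x ≤ u z → dot p x ≤ dot p z) (hpos : 0 < dot p x)
    (hy : nonneg y) (hxy : dot p y ≤ dot p x) : u y ≤ u x := by
  by_contra! hlt
  have hcont : ContinuousOn (fun t : ℝ => u (t • y)) (Set.Ici 0) :=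
    hu.comp (by fun_prop) fun t ht k => mul_nonneg ht (hy k)
  have hev : ∀ᶠ t in nhds (1 : ℝ), u x < u (t • y) :=
    (hcont.continuousAt (Ici_mem_nhds one_pos)).eventually_const_lt (by simpa using hlt)
  obtain ⟨t, ⟨hut, ht0⟩, ht1⟩ := (((hev.and (lt_mem_nhds one_pos)).filter_mono
    nhdsWithin_le_nhds).and (self_mem_nhdsWithin : Set.Iio (1 : ℝ) ∈ _)).exists
  have h := hx (t • y) (fun k => mul_nonneg (le_of_lt ht0) (hy k)) hut.le
  rw [dot_smul] at h
  have hty := mul_le_mul_of_nonneg_left hxy (le_of_lt ht0)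
  have : t * dot p x < 1 * dot p x := mul_lt_mul_of_pos_right ht1 hpos
  linarith

/-- Lemma A2, second part: every maximal element of the UPS belongs to the
VPS: markets clear and a single price vector rationalizes all utilities, with the induced
incomes forming an income distribution. -/
theorem maximal_UPS_mem_VPS {K N : ℕ} (hK : 1 ≤ K) (hN : 1 ≤ N)
    (w : Fin K → ℝ) (hw : posVec w)
    (u : Fin N → (Fin K → ℝ) → ℝ)
    (hu_cont : ∀ i, ContinuousOn (u i) {x | nonneg x})
    (hu_mono : ∀ i x y, nonneg x → nonneg y → (∀ k, x k ≤ y k) → x ≠ y → u i x < u i y)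
    (hu_qc : ∀ i (c : ℝ), Convex ℝ {x | nonneg x ∧ c ≤ u i x})
    (hu_diff : ∀ i, DifferentiableOn ℝ (u i) {x | posVec x})
    (v : Fin N → (Fin K → ℝ) → ℝ → ℝ)
    (hv : ∀ i, IsIndirectUtility (u i) (v i)) :
    ∀ x, Feasible w x →
      (∀ e' ∈ UPS w u, (∀ i, u i (x i) ≤ e' i) → e' = fun i => u i (x i)) →
      (∀ k, (∑ i, x i k) = w k) ∧
      ∃ p, PriceSimplex w p ∧ (∀ i, u i (x i) = v i p (dot p (x i))) ∧
        IncomeSimplex (fun i => dot p (x i)) := by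
  intro x hx hmax
  have hsum : ∑ i, x i = w := sum_eq_of_maximal hN hu_mono hmax hx fun _ => le_rfl
  refine ⟨fun k => by rw [← hsum, Finset.sum_apply], ?_⟩
  let k₀ : Fin K := ⟨0, hK⟩
  let S : Set (Fin N → Fin K → ℝ) := Set.univ.pi fun i => {z | nonneg z ∧ u i (x i) ≤ u i z}
  have hS : Convex ℝ S := convex_pi fun i _ => hu_qc i (u i (x i))
  have hxS : x ∈ S := fun i _ => ⟨hx.1 i, le_rfl⟩
  obtain ⟨p, hp1, hpA⟩ := exists_supporting_price (w := w)
    (hS.linear_image (∑ i, LinearMap.proj i)) ⟨x, hxS, by simpa using hsum⟩ (by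
      rintro _ ⟨y, hy, rfl⟩ hlt
      have hlt' : ∀ k, ∑ i, y i k < w k := fun k => by simpa using hlt k
      have h := sum_eq_of_maximal hN hu_mono hmax
        ⟨fun i => (hy i trivial).1, fun k => (hlt' k).le⟩ fun i => (hy i trivial).2
      have := hlt' k₀
      rw [← Finset.sum_apply, h] at this
      exact lt_irrefl _ this)
  have hpS : ∀ y ∈ S, dot p w ≤ dot p (∑ i, y i) := fun y hy =>
    hpA _ ⟨y, hy, by simp⟩
  have hexp : ∀ i z, nonneg z → u i (x i) ≤ u i z → dot p (x i) ≤ dot p z := by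
    intro i z hz hui
    have h := hpS (x + Pi.single i (z - x i)) fun j _ => by
      by_cases hj : j = i
      · subst hj; simpa using And.intro hz hui
      · simpa [hj] using hx.1 j
    simp only [Pi.add_apply, Finset.sum_add_distrib, hsum] at h
    rw [Finset.sum_pi_single', if_pos (Finset.mem_univ i), dot_add, dot_sub] at h
    linarith
  have hbump : ∀ i k, nonneg (x i + Pi.single k 1) ∧
      u i (x i) < u i (x i + Pi.single k 1) := by
    intro i k
    have hs : nonneg (Pi.single k 1 : Fin K → ℝ) := fun j =>
      (Pi.single_nonneg.2 (zero_le_one' ℝ) : (0 : Fin K → ℝ) ≤ Pi.single k 1) j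
    have hn : nonneg (x i + Pi.single k 1) := fun j => add_nonneg (hx.1 i j) (hs j)
    refine ⟨hn, hu_mono i _ _ (hx.1 i) hn (fun j => le_add_of_nonneg_right (hs j)) ?_⟩
    simp
  have hp0 : nonneg p := fun k => by
    obtain ⟨hn, hlt⟩ := hbump ⟨0, hN⟩ k
    have h := hexp _ _ hn hlt.le
    rw [dot_add, dot_single] at h
    linarith
  have hpw : 0 < dot p w := by
    obtain ⟨k, hk, hpk⟩ := Finset.exists_lt_of_sum_lt (s := Finset.univ) (f := fun _ => (0 : ℝ))
      (g := fun k => p k) (by simpa [dot] using hp1)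
    exact Finset.sum_pos' (fun k _ => mul_nonneg (hp0 k) (hw k).le)
      ⟨k, Finset.mem_univ k, mul_pos hpk (hw k)⟩
  have hpsum : ∑ i, dot p (x i) = dot p w := by rw [← dot_sum, hsum]
  have hpp : posVec p := by
    obtain ⟨j, -, hj⟩ := Finset.exists_lt_of_sum_lt (s := Finset.univ) (f := fun _ => (0 : ℝ))
      (g := fun i => dot p (x i)) (by simpa [hpsum] using hpw)
    intro k
    by_contra! hk
    obtain ⟨hn, hlt⟩ := hbump j k
    refine hlt.not_ge (le_of_dot_le_of_dot_pos (hu_cont j) (hexp j) hj hn ?_)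
    rw [dot_add, dot_single]
    linarith
  have hopt : ∀ i y, nonneg y → dot p y ≤ dot p (x i) → u i y ≤ u i (x i) := by
    intro i y hy hle
    rcases (dot_nonneg hp0 (hx.1 i)).eq_or_lt' with h | h
    · rw [eq_zero_of_dot_nonpos hpp hy (hle.trans h.le),
        eq_zero_of_dot_nonpos hpp (hx.1 i) h.le]
    · exact le_of_dot_le_of_dot_pos (hu_cont i) (hexp i) h hy hle
  have hc : 0 < (dot p w)⁻¹ := inv_pos.2 hpw
  have hqpos : posVec ((dot p w)⁻¹ • p) := fun k => mul_pos hc (hpp k)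
  have hqx : ∀ i, 0 ≤ dot ((dot p w)⁻¹ • p) (x i) := fun i =>
    dot_nonneg (fun k => (hqpos k).le) (hx.1 i)
  refine ⟨(dot p w)⁻¹ • p, ⟨hqpos, ?_⟩, fun i => ?_, hqx, ?_⟩
  · rw [smul_dot, inv_mul_cancel₀ hpw.ne']
  · refine ((hv i _ _ hqpos (hqx i)).unique ⟨⟨x i, hx.1 i, le_rfl, rfl⟩, ?_⟩).symm
    rintro _ ⟨y, hy, hle, rfl⟩
    rw [smul_dot, smul_dot] at hle
    exact hopt i y hy (le_of_mul_le_mul_left hle hc)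
  · simp only [smul_dot, ← Finset.mul_sum, hpsum]
    exact inv_mul_cancel₀ hpw.ne'
end

section
/- (First welfare theorem.) Assume each utility u_i is continuous and strictly increasing. If (x,p) is a Walrasian equilibrium with income distribution m ∈ Σ_N, then the allocation x is Pareto optimal. -/
theorem dot_mono {K : ℕ} {p x y : Fin K → ℝ} (hp : posVec p) (h : ∀ k, x k ≤ y k) :
    dot p x ≤ dot p y :=
  Finset.sum_le_sum fun k _ => mul_le_mul_of_nonneg_left (h k) (hp k).le

theorem sum_dot {K N : ℕ} (p : Fin K → ℝ) (x : Fin N → Fin K → ℝ) :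
    ∑ i, dot p (x i) = dot p (fun k => ∑ i, x i k) := by
  simp only [dot, Finset.mul_sum]
  exact Finset.sum_comm

theorem dot_add_single {K : ℕ} (p x : Fin K → ℝ) (k : Fin K) (d : ℝ) :
    dot p (x + Pi.single k d) = dot p x + p k * d := by
  simp [dot, mul_add, Finset.sum_add_distrib, Pi.single_apply]

theorem IsIndirectUtility.le {K : ℕ} {u : (Fin K → ℝ) → ℝ} {v : (Fin K → ℝ) → ℝ → ℝ}
    (hv : IsIndirectUtility u v) {p x : Fin K → ℝ} {m : ℝ} (hp : posVec p) (hm : 0 ≤ m)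
    (hx : nonneg x) (h : dot p x ≤ m) : u x ≤ v p m :=
  (hv p m hp hm).2 ⟨x, hx, h, rfl⟩

/-- With a strictly increasing utility, a bundle costing strictly less than the income is strictly
worse than the optimal one. -/
theorem IsIndirectUtility.lt {K : ℕ} (hK : 1 ≤ K) {u : (Fin K → ℝ) → ℝ}
    {v : (Fin K → ℝ) → ℝ → ℝ} (hv : IsIndirectUtility u v)
    (hu : ∀ x y, nonneg x → nonneg y → (∀ k, x k ≤ y k) → x ≠ y → u x < u y)
    {p x : Fin K → ℝ} {m : ℝ} (hp : posVec p) (hm : 0 ≤ m)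
    (hx : nonneg x) (h : dot p x < m) : u x < v p m := by
  let k : Fin K := ⟨0, hK⟩
  let d : ℝ := (m - dot p x) / p k
  have hd : 0 < d := div_pos (sub_pos.2 h) (hp k)
  have hle : x ≤ x + Pi.single k d := le_add_of_nonneg_right (Pi.single_nonneg.2 hd.le)
  have hy : nonneg (x + Pi.single k d) := fun j => (hx j).trans (hle j)
  have hne : x ≠ x + Pi.single k d := fun heq => by
    have := congrFun heq k
    simp [hd.ne'] at this
  refine (hu x _ hx hy hle hne).trans_le (hv.le hp hm hy ?_)
  rw [dot_add_single, mul_div_cancel₀ _ (hp k).ne']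
  linarith

/-- First welfare theorem: Walrasian equilibrium allocations are Pareto
optimal. -/
theorem first_welfare_theorem {K N : ℕ} (hK : 1 ≤ K) (hN : 1 ≤ N)
    (w : Fin K → ℝ) (hw : posVec w)
    (u : Fin N → (Fin K → ℝ) → ℝ)
    (hu_cont : ∀ i, ContinuousOn (u i) {x | nonneg x})
    (hu_mono : ∀ i x y, nonneg x → nonneg y → (∀ k, x k ≤ y k) → x ≠ y → u i x < u i y)
    (v : Fin N → (Fin K → ℝ) → ℝ → ℝ)
    (hv : ∀ i, IsIndirectUtility (u i) (v i)) :
    ∀ x p m, IncomeSimplex m → WalrasEq w u v x p m → ParetoOptimal w u x := by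
  rintro x p m ⟨hm, hm1⟩ ⟨hx, ⟨hp, hpw⟩, hopt⟩
  refine ⟨hx, ?_⟩
  rintro ⟨x', ⟨hx', hfeas⟩, hge, j, hj⟩
  have hcost : ∀ i, m i ≤ dot p (x' i) := fun i => by
    by_contra! hlt
    have := (hv i).lt hK (hu_mono i) hp (hm i) (hx' i) hlt
    linarith [hge i, (hopt i).2]
  have hcostj : m j < dot p (x' j) := by
    by_contra! hle
    have := (hv j).le hp (hm j) (hx' j) hle
    linarith [(hopt j).2]
  have hlt : ∑ i, m i < ∑ i, dot p (x' i) :=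
    Finset.sum_lt_sum (fun i _ => hcost i) ⟨j, Finset.mem_univ j, hcostj⟩
  have hle : ∑ i, dot p (x' i) ≤ dot p w := by
    rw [sum_dot]
    exact dot_mono hp hfeas
  linarith
end

section
/- Let u : B(w) → ℝ be continuous and non-decreasing, with restricted-domain indirect utility v̄(p,m) = max{u(x) : x ∈ B(w), ⟨p,x⟩ ≤ m}, and let ū(x) = inf{v̄(p, ⟨p,x⟩) : p ∈ ℝ^K strictly positive} be its quasiconcavification. Then u and ū have the same indirect utility: for every strictly positive p ∈ ℝ^K and every m ≥ 0, max{ū(x) : x ∈ B(w), ⟨p,x⟩ ≤ m} = v̄(p,m). -/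
/-- The box `B(w) = {x : 0 ≤ x ≤ w}` of bundles dominated by the total endowment. -/
def Box {K : ℕ} (w : Fin K → ℝ) : Set (Fin K → ℝ) := {x | ∀ k, 0 ≤ x k ∧ x k ≤ w k}

/-- `vbar` is the restricted-domain indirect utility of `u : B(w) → ℝ`:
`vbar p m = max {u x : x ∈ B(w), ⟨p,x⟩ ≤ m}` for strictly positive `p` and `m ≥ 0`. -/
def IsRestrictedIndirectUtility {K : ℕ} (w : Fin K → ℝ) (u : (Fin K → ℝ) → ℝ)
    (vbar : (Fin K → ℝ) → ℝ → ℝ) : Prop :=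
  ∀ p m, posVec p → 0 ≤ m →
    IsGreatest {t | ∃ x ∈ Box w, dot p x ≤ m ∧ u x = t} (vbar p m)

/-- The quasiconcavification `ū(x) = inf {vbar (p, ⟨p,x⟩) : p strictly positive}`. -/
noncomputable def quasiConcavification {K : ℕ} (vbar : (Fin K → ℝ) → ℝ → ℝ)
    (x : Fin K → ℝ) : ℝ :=
  sInf {t | ∃ p, posVec p ∧ vbar p (dot p x) = t}

theorem dot_nonneg_of_mem_Box {K : ℕ} {w p x : Fin K → ℝ} (hp : posVec p) (hx : x ∈ Box w) :
    0 ≤ dot p x :=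
  Finset.sum_nonneg fun k _ => mul_nonneg (hp k).le (hx k).1

/-- The quasiconcavification dominates the original utility on the box. -/
theorem le_quasiConcavification {K : ℕ} {w : Fin K → ℝ} {u : (Fin K → ℝ) → ℝ}
    {vbar : (Fin K → ℝ) → ℝ → ℝ} (hvbar : IsRestrictedIndirectUtility w u vbar)
    {x : Fin K → ℝ} (hx : x ∈ Box w) : u x ≤ quasiConcavification vbar x := by
  refine le_csInf ⟨_, fun _ => 1, fun _ => one_pos, rfl⟩ ?_
  rintro _ ⟨q, hq, rfl⟩
  exact (hvbar q _ hq (dot_nonneg_of_mem_Box hq hx)).2 ⟨x, hx, le_rfl, rfl⟩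

/-- On a budget set, the quasiconcavification is at most the indirect utility. -/
theorem quasiConcavification_le {K : ℕ} {w : Fin K → ℝ} {u : (Fin K → ℝ) → ℝ}
    {vbar : (Fin K → ℝ) → ℝ → ℝ} (hvbar : IsRestrictedIndirectUtility w u vbar)
    {p x : Fin K → ℝ} {m : ℝ} (hp : posVec p) (hx : x ∈ Box w) (hxm : dot p x ≤ m) :
    quasiConcavification vbar x ≤ vbar p m := by
  have hpx := dot_nonneg_of_mem_Box hp hx
  have hbdd : BddBelow {t | ∃ q, posVec q ∧ vbar q (dot q x) = t} := by
    refine ⟨u x, ?_⟩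
    rintro _ ⟨q, hq, rfl⟩
    exact (hvbar q _ hq (dot_nonneg_of_mem_Box hq hx)).2 ⟨x, hx, le_rfl, rfl⟩
  refine (csInf_le hbdd ⟨p, hp, rfl⟩).trans ?_
  obtain ⟨y, hy, hyx, huy⟩ := (hvbar p _ hp hpx).1
  exact (hvbar p m hp (hpx.trans hxm)).2 ⟨y, hy, hyx.trans hxm, huy⟩

/-- the quasiconcavification `ū` has the same indirect utility as `u`:
for every strictly positive `p` and `m ≥ 0`,
`max {ū(x) : x ∈ B(w), ⟨p,x⟩ ≤ m} = vbar p m`. -/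
theorem quasiConcavification_same_indirect_utility {K : ℕ} (hK : 1 ≤ K)
    (w : Fin K → ℝ) (hw : posVec w)
    (u : (Fin K → ℝ) → ℝ)
    (hu_cont : ContinuousOn u (Box w))
    (hu_mono : ∀ x ∈ Box w, ∀ y ∈ Box w, (∀ k, x k ≤ y k) → u x ≤ u y)
    (vbar : (Fin K → ℝ) → ℝ → ℝ)
    (hvbar : IsRestrictedIndirectUtility w u vbar) :
    ∀ p m, posVec p → 0 ≤ m →
      IsGreatest {t | ∃ x ∈ Box w, dot p x ≤ m ∧ quasiConcavification vbar x = t}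
        (vbar p m) := by
  intro p m hp hm
  refine ⟨?_, ?_⟩
  · obtain ⟨x, hx, hxm, hux⟩ := (hvbar p m hp hm).1
    exact ⟨x, hx, hxm, le_antisymm (quasiConcavification_le hvbar hp hx hxm)
      (hux ▸ le_quasiConcavification hvbar hx)⟩
  · rintro _ ⟨x, hx, hxm, rfl⟩
    exact quasiConcavification_le hvbar hp hx hxm
end

section
/- Consider the exchange economy with K = 2 goods and N = 2 consumers whose utilities are u_1(x,y) = u_2(x,y) = max(x,y) on ℝ_{≥0}^2, with endowments ω_1 = (2,2) and ω_2 = (1,1) (so total endowment w = (3,3)). Then no Walrasian equilibrium exists: there is no nonzero price vector p ∈ ℝ_{≥0}^2 and feasible allocation (x_1,x_2) (x_i ∈ ℝ_{≥0}^2 with x_1 + x_2 ≤ (3,3)) such that for each i = 1,2, ⟨p,x_i⟩ ≤ ⟨p,ω_i⟩ and u_i(x_i) ≥ u_i(x') for every x' ∈ ℝ_{≥0}^2 with ⟨p,x'⟩ ≤ ⟨p,ω_i⟩. -/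
/-- Inner product on `ℝ²` represented as pairs. -/
noncomputable def dot2 (p x : ℝ × ℝ) : ℝ := p.1 * x.1 + p.2 * x.2

/-- Nonnegative bundle. -/
def nonneg2 (x : ℝ × ℝ) : Prop := 0 ≤ x.1 ∧ 0 ≤ x.2

/-- The "max" utility `u(x,y) = max(x,y)`. -/
noncomputable def maxUtility (x : ℝ × ℝ) : ℝ := max x.1 x.2

/-- in the exchange economy with two "max"-preference consumers with
endowments `(2,2)` and `(1,1)`, no Walrasian equilibrium exists. -/
theorem max_preferences_no_walras_equilibrium :
    ¬ ∃ (p x1 x2 : ℝ × ℝ),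
      nonneg2 p ∧ p ≠ 0 ∧
      nonneg2 x1 ∧ nonneg2 x2 ∧
      x1.1 + x2.1 ≤ 3 ∧ x1.2 + x2.2 ≤ 3 ∧
      dot2 p x1 ≤ dot2 p (2, 2) ∧ dot2 p x2 ≤ dot2 p (1, 1) ∧
      (∀ x' : ℝ × ℝ, nonneg2 x' → dot2 p x' ≤ dot2 p (2, 2) →
        maxUtility x' ≤ maxUtility x1) ∧
      (∀ x' : ℝ × ℝ, nonneg2 x' → dot2 p x' ≤ dot2 p (1, 1) →
        maxUtility x' ≤ maxUtility x2) := by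
  rintro ⟨p, x1, x2, -, -, -, hx2, hfst, hsnd, -, -, hmax, -⟩
  have hle : maxUtility x1 ≤ 3 :=
    max_le (by linarith [hx2.1]) (by linarith [hx2.2])
  -- Four units of the cheaper good are affordable for the first consumer.
  have hge : 4 ≤ maxUtility x1 := by
    rcases le_total p.1 p.2 with h | h
    · simpa [maxUtility] using
        hmax (4, 0) (by norm_num [nonneg2]) (by simp only [dot2]; linarith)
    · simpa [maxUtility] using
        hmax (0, 4) (by norm_num [nonneg2]) (by simp only [dot2]; linarith)
  linarith
end
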